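/- arXiv:0812.5056 — 4 statements merged into one kernel-verified Lean document; each statement's English description precedes it below -/
import Mathlib

section
/- In the setting of the Cartan calculus package with divergence operator D, for every t ∈ ℂ the operators L^{(t)} are compatible with the differentials: for every γ ∈ T[[u]] homogeneous of total degree |γ| (where u has degree +2) one has the graded commutator identity [u d, L^{(t)}_γ] = (u d) L^{(t)}_γ − (−1)^{|γ|} L^{(t)}_γ (u d) = L^{(t)}_{u D γ} as operators on V[[u]]. -/
/-- The Lie derivative `L_γ = [d, ι_γ] = d ∘ ι_γ − (−1)^{(−1)·k} ι_γ ∘ d` of an element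
`γ` of degree `k` (the operator `ι_γ` has degree `k` and `d` has degree `−1`, so the sign in
the graded commutator is `(−1)^{−k} = (−1)^k`). -/
noncomputable def Lder {T V : Type} [AddCommGroup T] [Module ℂ T]
    [AddCommGroup V] [Module ℂ V]
    (d : V →ₗ[ℂ] V) (iota : T →ₗ[ℂ] V →ₗ[ℂ] V) (k : ℤ) (γ : T) : V →ₗ[ℂ] V :=
  d ∘ₗ iota γ - ((-1 : ℂ) ^ k) • (iota γ ∘ₗ d)

/-- An element of `T[[u]]` is encoded as its sequence of coefficients `γ : ℕ → T`,
`γ = Σ_{j≥0} u^j γ_j`; similarly an element of `V[[u]]` is encoded as `x : ℕ → V`.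
`uDiff d` is the operator `u·d` on `V[[u]]`: `(u d x)_n = d(x_{n−1})`, `(u d x)_0 = 0`. -/
def uDiff {V : Type} [AddCommGroup V] [Module ℂ V] (d : V →ₗ[ℂ] V) :
    (ℕ → V) → (ℕ → V) := fun x n =>
  match n with
  | 0 => 0
  | m + 1 => d (x m)

/-- The element `u·(D γ)` of `T[[u]]` for `γ = Σ u^j γ_j ∈ T[[u]]`. -/
def uMapT {T : Type} [AddCommGroup T] [Module ℂ T] (D : T →ₗ[ℂ] T) (γ : ℕ → T) :
    ℕ → T := fun n =>
  match n with
  | 0 => 0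
  | m + 1 => D (γ m)

/-- The `u`-bilinear extension of the bracket of `T` to `T[[u]]`. -/
def ubr {T : Type} [AddCommGroup T] [Module ℂ T] (bracket : T →ₗ[ℂ] T →ₗ[ℂ] T)
    (γ ν : ℕ → T) : ℕ → T := fun n =>
  ∑ p ∈ Finset.range (n + 1), bracket (γ p) (ν (n - p))

/-- The operator `L^{(t)}_γ := Σ_{j≥0} (ut)^j (L_{γ_j} + t ι_{D γ_j})` on `V[[u]]`, for
`γ = Σ_{j≥0} u^j γ_j ∈ T[[u]]` homogeneous of total degree `k` (so `γ_j ∈ T^{k−2j}`,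
`u` having degree `+2`). -/
noncomputable def Lt {T V : Type} [AddCommGroup T] [Module ℂ T]
    [AddCommGroup V] [Module ℂ V]
    (d : V →ₗ[ℂ] V) (iota : T →ₗ[ℂ] V →ₗ[ℂ] V) (D : T →ₗ[ℂ] T)
    (k : ℤ) (γ : ℕ → T) (t : ℂ) : (ℕ → V) → (ℕ → V) := fun x n =>
  ∑ j ∈ Finset.range (n + 1),
    t ^ j • (Lder d iota (k - 2 * (j : ℤ)) (γ j) (x (n - j))
      + t • iota (D (γ j)) (x (n - j)))

/-- The homotopy operator `h^{(t)}_γ := −Σ_{j≥1} j t^{j−1} u^{j−1} ι_{γ_j}` on `V[[u]]`. -/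
noncomputable def ht {T V : Type} [AddCommGroup T] [Module ℂ T]
    [AddCommGroup V] [Module ℂ V]
    (iota : T →ₗ[ℂ] V →ₗ[ℂ] V) (γ : ℕ → T) (t : ℂ) : (ℕ → V) → (ℕ → V) := fun x n =>
  -∑ j ∈ Finset.range (n + 1),
      (((j + 1 : ℕ) : ℂ) * t ^ j) • iota (γ (j + 1)) (x (n - j))

theorem neg_one_zpow_sub_two_mul (k j : ℤ) : (-1 : ℂ) ^ (k - 2 * j) = (-1 : ℂ) ^ k := by
  rw [zpow_sub₀ (by norm_num), zpow_mul]
  norm_num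

theorem neg_one_zpow_sub_one (k : ℤ) : (-1 : ℂ) ^ (k - 1) = -(-1 : ℂ) ^ k := by
  rw [zpow_sub_one₀ (by norm_num)]
  norm_num

/-- The Lie derivative commutes with `d` in the graded sense. -/
theorem d_Lder_apply {T V : Type} [AddCommGroup T] [Module ℂ T] [AddCommGroup V] [Module ℂ V]
    {d : V →ₗ[ℂ] V} (hd2 : d ∘ₗ d = 0) (iota : T →ₗ[ℂ] V →ₗ[ℂ] V) (k : ℤ) (γ : T) (x : V) :
    d (Lder d iota k γ x) = (-1 : ℂ) ^ (k - 1) • Lder d iota k γ (d x) := by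
  have hd (y : V) : d (d y) = 0 := LinearMap.congr_fun hd2 y
  simp [Lder, hd, neg_one_zpow_sub_one]

/-!
STATEMENT 4: for every `t ∈ ℂ` the operators `L^{(t)}` are compatible with the differentials:
for every homogeneous `γ ∈ T[[u]]` of total degree `k` (so `|γ| = k − 1`),
`[u d, L^{(t)}_γ] = (u d) L^{(t)}_γ − (−1)^{|γ|} L^{(t)}_γ (u d) = L^{(t)}_{u D γ}`
as operators on `V[[u]]` (here `u D γ` is homogeneous of total degree `k + 1`).
-/
theorem Lt_compatible_with_differentials
    {T V : Type} [AddCommGroup T] [Module ℂ T] [AddCommGroup V] [Module ℂ V]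
    -- the grading of `T` (with `T^{•+1}` a graded Lie algebra; `|γ| = k − 1` for `γ ∈ T^k`)
    (Tk : ℤ → Submodule ℂ T) (hT : DirectSum.IsInternal Tk)
    (bracket : T →ₗ[ℂ] T →ₗ[ℂ] T)
    (hbr_mem : ∀ (k l : ℤ) (γ ν : T), γ ∈ Tk k → ν ∈ Tk l → bracket γ ν ∈ Tk (k + l - 1))
    (hbr_skew : ∀ (k l : ℤ) (γ ν : T), γ ∈ Tk k → ν ∈ Tk l →
      bracket γ ν = -(((-1 : ℂ) ^ ((k - 1) * (l - 1))) • bracket ν γ))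
    (hbr_jacobi : ∀ (k l m : ℤ) (γ ν η : T), γ ∈ Tk k → ν ∈ Tk l → η ∈ Tk m →
      bracket γ (bracket ν η)
        = bracket (bracket γ ν) η + ((-1 : ℂ) ^ ((k - 1) * (l - 1))) • bracket ν (bracket γ η))
    -- the grading of `V` and the differential `d` of degree `−1`
    (Vk : ℤ → Submodule ℂ V) (hV : DirectSum.IsInternal Vk)
    (d : V →ₗ[ℂ] V) (hd_mem : ∀ (m : ℤ) (x : V), x ∈ Vk m → d x ∈ Vk (m - 1))
    (hd2 : d ∘ₗ d = 0)
    -- the insertion operators `ι_γ : V^m → V^{m+k}` for `γ ∈ T^k`, linear in `γ`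
    (iota : T →ₗ[ℂ] V →ₗ[ℂ] V)
    (hiota_mem : ∀ (k m : ℤ) (γ : T) (x : V), γ ∈ Tk k → x ∈ Vk m → iota γ x ∈ Vk (m + k))
    (hiota_comm : ∀ (k l : ℤ) (γ ν : T), γ ∈ Tk k → ν ∈ Tk l →
      iota γ ∘ₗ iota ν = ((-1 : ℂ) ^ (k * l)) • (iota ν ∘ₗ iota γ))
    -- the Cartan relations `ι_{[γ,ν]} = [ι_γ, L_ν] = (−1)^{|γ|} [L_γ, ι_ν]`
    (hcartan₁ : ∀ (k l : ℤ) (γ ν : T), γ ∈ Tk k → ν ∈ Tk l →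
      iota (bracket γ ν)
        = iota γ ∘ₗ Lder d iota l ν
          - ((-1 : ℂ) ^ (k * (l - 1))) • (Lder d iota l ν ∘ₗ iota γ))
    (hcartan₂ : ∀ (k l : ℤ) (γ ν : T), γ ∈ Tk k → ν ∈ Tk l →
      iota (bracket γ ν)
        = ((-1 : ℂ) ^ (k - 1)) •
            (Lder d iota k γ ∘ₗ iota ν
              - ((-1 : ℂ) ^ ((k - 1) * l)) • (iota ν ∘ₗ Lder d iota k γ)))
    -- the divergence operator `D` of degree `−1`, a derivation of the bracket with `D² = 0`
    (D : T →ₗ[ℂ] T) (hD_mem : ∀ (k : ℤ) (γ : T), γ ∈ Tk k → D γ ∈ Tk (k - 1))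
    (hD2 : D ∘ₗ D = 0)
    (hD_der : ∀ (k l : ℤ) (γ ν : T), γ ∈ Tk k → ν ∈ Tk l →
      D (bracket γ ν) = bracket (D γ) ν + ((-1 : ℂ) ^ (k - 1)) • bracket γ (D ν))
    :
    ∀ (t : ℂ) (k : ℤ) (γ : ℕ → T), (∀ j : ℕ, γ j ∈ Tk (k - 2 * (j : ℤ))) →
      ∀ (x : ℕ → V) (n : ℕ),
        uDiff d (Lt d iota D k γ t x) n
            - ((-1 : ℂ) ^ (k - 1)) • Lt d iota D k γ t (uDiff d x) n
          = Lt d iota D (k + 1) (uMapT D γ) t x n := by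
  intro t k γ _ x n
  have hDD (y : T) : D (D y) = 0 := LinearMap.congr_fun hD2 y
  cases n with
  | zero => simp [Lt, uDiff, uMapT, Lder]
  | succ m =>
    have hleft : Lt d iota D k γ t (uDiff d x) (m + 1) =
        ∑ j ∈ Finset.range (m + 1), t ^ j • (Lder d iota (k - 2 * (j : ℤ)) (γ j) (d (x (m - j)))
          + t • iota (D (γ j)) (d (x (m - j)))) := by
      rw [Lt, Finset.sum_range_succ]
      simp only [Nat.sub_self, uDiff, map_zero, smul_zero, add_zero]
      refine Finset.sum_congr rfl fun j hj => ?_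
      rw [Nat.succ_sub (Nat.lt_succ_iff.mp (Finset.mem_range.mp hj))]
    have hright : Lt d iota D (k + 1) (uMapT D γ) t x (m + 1) =
        ∑ j ∈ Finset.range (m + 1),
          t ^ (j + 1) • Lder d iota (k - 1 - 2 * (j : ℤ)) (D (γ j)) (x (m - j)) := by
      rw [Lt, Finset.sum_range_succ']
      simp only [uMapT, hDD, map_zero, LinearMap.zero_apply, smul_zero, add_zero,
        Nat.add_sub_add_right]
      simp only [Lder, map_zero, LinearMap.comp_zero, LinearMap.zero_comp, smul_zero, sub_zero,
        LinearMap.zero_apply, add_zero]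
      refine Finset.sum_congr rfl fun j _ => ?_
      rw [show k + 1 - 2 * ((j + 1 : ℕ) : ℤ) = k - 1 - 2 * (j : ℤ) by push_cast; ring]
    rw [hleft, hright]
    simp only [uDiff, Lt, map_sum, Finset.smul_sum]
    rw [← Finset.sum_sub_distrib]
    refine Finset.sum_congr rfl fun j _ => ?_
    rw [map_smul, map_add, d_Lder_apply hd2, map_smul]
    simp only [Lder, LinearMap.sub_apply, LinearMap.smul_apply, LinearMap.comp_apply,
      neg_one_zpow_sub_one, neg_one_zpow_sub_two_mul]
    module
end

section
/- In the setting of the Cartan calculus package with divergence operator D, for every t ∈ ℂ the operators L^{(t)} are compatible with the brackets: for all homogeneous γ, ν ∈ T[[u]] one has the graded commutator identity [L^{(t)}_γ, L^{(t)}_ν] = L^{(t)}_γ L^{(t)}_ν − (−1)^{|γ||ν|} L^{(t)}_ν L^{(t)}_γ = L^{(t)}_{[γ,ν]} as operators on V[[u]], where [γ,ν] denotes the u-bilinear extension of the bracket of T. (Together with the compatibility with the differentials, this says that for every t ∈ ℂ, L^{(t)} defines a differential graded Lie algebra module structure on (V[[u]], u d) over (T[[u]], u D, [·,·]).) -/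
theorem neg_one_zpow_eq_ite_even (m : ℤ) : (-1 : ℂ) ^ m = if Even m then 1 else -1 := by
  split_ifs with h
  · exact h.neg_one_zpow
  · exact (Int.not_even_iff_odd.mp h).neg_one_zpow

/-- The coefficient `L_γ + t ι_{D γ}` of `(ut)^j` in `L^{(t)}`. -/
noncomputable def LtCoeff {T V : Type} [AddCommGroup T] [Module ℂ T]
    [AddCommGroup V] [Module ℂ V] (d : V →ₗ[ℂ] V) (iota : T →ₗ[ℂ] V →ₗ[ℂ] V)
    (D : T →ₗ[ℂ] T) (t : ℂ) (k : ℤ) : T →ₗ[ℂ] V →ₗ[ℂ] V where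
  toFun γ := Lder d iota k γ + t • iota (D γ)
  map_add' γ ν := by
    ext x
    simp only [Lder, map_add, LinearMap.add_apply, LinearMap.sub_apply, LinearMap.smul_apply,
      LinearMap.comp_apply]
    module
  map_smul' c γ := by
    ext x
    simp only [Lder, map_smul, LinearMap.add_apply, LinearMap.sub_apply, LinearMap.smul_apply,
      LinearMap.comp_apply, RingHom.id_apply]
    module

theorem LtCoeff_apply {T V : Type} [AddCommGroup T] [Module ℂ T]
    [AddCommGroup V] [Module ℂ V] (d : V →ₗ[ℂ] V) (iota : T →ₗ[ℂ] V →ₗ[ℂ] V)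
    (D : T →ₗ[ℂ] T) (t : ℂ) (k : ℤ) (γ : T) (x : V) :
    LtCoeff d iota D t k γ x = Lder d iota k γ x + t • iota (D γ) x := rfl

theorem Lt_eq_sum_antidiagonal {T V : Type} [AddCommGroup T] [Module ℂ T]
    [AddCommGroup V] [Module ℂ V] (d : V →ₗ[ℂ] V) (iota : T →ₗ[ℂ] V →ₗ[ℂ] V)
    (D : T →ₗ[ℂ] T) (k : ℤ) (γ : ℕ → T) (t : ℂ) (x : ℕ → V) (n : ℕ) :
    Lt d iota D k γ t x n = ∑ p ∈ Finset.HasAntidiagonal.antidiagonal n,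
      t ^ p.1 • LtCoeff d iota D t (k - 2 * (p.1 : ℤ)) (γ p.1) (x p.2) :=
  (Finset.Nat.sum_antidiagonal_eq_sum_range_succ
    (fun i j => t ^ i • LtCoeff d iota D t (k - 2 * (i : ℤ)) (γ i) (x j)) n).symm

theorem Lt_Lt_eq_sum_antidiagonal {T V : Type} [AddCommGroup T] [Module ℂ T]
    [AddCommGroup V] [Module ℂ V] (d : V →ₗ[ℂ] V) (iota : T →ₗ[ℂ] V →ₗ[ℂ] V)
    (D : T →ₗ[ℂ] T) (k l : ℤ) (γ ν : ℕ → T) (t : ℂ) (x : ℕ → V) (n : ℕ) :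
    Lt d iota D k γ t (Lt d iota D l ν t x) n = ∑ p ∈ Finset.HasAntidiagonal.antidiagonal n,
      ∑ q ∈ Finset.HasAntidiagonal.antidiagonal p.1, t ^ p.1 •
        LtCoeff d iota D t (k - 2 * (q.1 : ℤ)) (γ q.1)
          (LtCoeff d iota D t (l - 2 * (q.2 : ℤ)) (ν q.2) (x p.2)) := by
  simp only [Lt_eq_sum_antidiagonal, map_sum, map_smul, Finset.smul_sum, smul_smul, ← pow_add]
  rw [Finset.sum_sigma', Finset.sum_sigma']
  refine Finset.sum_nbij' (fun s => ⟨(s.1.1 + s.2.1, s.2.2), (s.1.1, s.2.1)⟩)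
    (fun s => ⟨(s.2.1, s.2.2 + s.1.2), (s.2.2, s.1.2)⟩) ?_ ?_ ?_ ?_ ?_
  all_goals
    simp only [Finset.mem_sigma, Finset.HasAntidiagonal.mem_antidiagonal]
    rintro ⟨⟨a, b⟩, c, e⟩ ⟨rfl, h⟩
    simp only at h
    subst h
    simp [add_assoc]

theorem Lder_commutator {T V : Type} [AddCommGroup T] [Module ℂ T]
    [AddCommGroup V] [Module ℂ V] (d : V →ₗ[ℂ] V) (hd2 : d ∘ₗ d = 0)
    (iota : T →ₗ[ℂ] V →ₗ[ℂ] V) (k l : ℤ) (γ ν β : T)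
    (hcartan : iota β = ((-1 : ℂ) ^ (k - 1)) •
      (Lder d iota k γ ∘ₗ iota ν - ((-1 : ℂ) ^ ((k - 1) * l)) • (iota ν ∘ₗ Lder d iota k γ)))
    (x : V) :
    Lder d iota k γ (Lder d iota l ν x)
        - ((-1 : ℂ) ^ ((k - 1) * (l - 1))) • Lder d iota l ν (Lder d iota k γ x)
      = Lder d iota (k + l - 1) β x := by
  have hd : ∀ y, d (d y) = 0 := fun y => LinearMap.congr_fun hd2 y
  have hβ : ∀ y, iota β y = _ := fun y => LinearMap.congr_fun hcartan y
  simp only [Lder, LinearMap.sub_apply, LinearMap.smul_apply, LinearMap.comp_apply, map_sub,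
    map_smul, hd, map_zero] at hβ ⊢
  simp only [hβ, map_sub, map_smul, hd, map_zero]
  by_cases hk : Even k <;> by_cases hl : Even l <;>
    simp only [neg_one_zpow_eq_ite_even, Int.even_mul, Int.even_sub, Int.even_add, Int.not_even_one,
      hk, hl, iff_false, not_true_eq_false, or_true, or_false, or_self,
      iff_true, if_true, if_false] <;>
    module

theorem LtCoeff_commutator {T V : Type} [AddCommGroup T] [Module ℂ T]
    [AddCommGroup V] [Module ℂ V] (Tk : ℤ → Submodule ℂ T) (bracket : T →ₗ[ℂ] T →ₗ[ℂ] T)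
    (d : V →ₗ[ℂ] V) (hd2 : d ∘ₗ d = 0) (iota : T →ₗ[ℂ] V →ₗ[ℂ] V)
    (hiota_comm : ∀ (k l : ℤ) (γ ν : T), γ ∈ Tk k → ν ∈ Tk l →
      iota γ ∘ₗ iota ν = ((-1 : ℂ) ^ (k * l)) • (iota ν ∘ₗ iota γ))
    (hcartan₁ : ∀ (k l : ℤ) (γ ν : T), γ ∈ Tk k → ν ∈ Tk l →
      iota (bracket γ ν)
        = iota γ ∘ₗ Lder d iota l ν
          - ((-1 : ℂ) ^ (k * (l - 1))) • (Lder d iota l ν ∘ₗ iota γ))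
    (hcartan₂ : ∀ (k l : ℤ) (γ ν : T), γ ∈ Tk k → ν ∈ Tk l →
      iota (bracket γ ν)
        = ((-1 : ℂ) ^ (k - 1)) •
            (Lder d iota k γ ∘ₗ iota ν
              - ((-1 : ℂ) ^ ((k - 1) * l)) • (iota ν ∘ₗ Lder d iota k γ)))
    (D : T →ₗ[ℂ] T) (hD_mem : ∀ (k : ℤ) (γ : T), γ ∈ Tk k → D γ ∈ Tk (k - 1))
    (hD_der : ∀ (k l : ℤ) (γ ν : T), γ ∈ Tk k → ν ∈ Tk l →
      D (bracket γ ν) = bracket (D γ) ν + ((-1 : ℂ) ^ (k - 1)) • bracket γ (D ν))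
    (t : ℂ) {k l : ℤ} {γ ν : T} (hγ : γ ∈ Tk k) (hν : ν ∈ Tk l) (x : V) :
    LtCoeff d iota D t k γ (LtCoeff d iota D t l ν x)
        - ((-1 : ℂ) ^ ((k - 1) * (l - 1))) • LtCoeff d iota D t l ν (LtCoeff d iota D t k γ x)
      = LtCoeff d iota D t (k + l - 1) (bracket γ ν) x := by
  have hDγ := hD_mem k γ hγ
  have hDν := hD_mem l ν hν
  have hLL := Lder_commutator d hd2 iota k l γ ν _ (hcartan₂ k l γ ν hγ hν) x
  have hιι := LinearMap.congr_fun (hiota_comm _ _ _ _ hDγ hDν) x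
  have hιL := LinearMap.congr_fun (hcartan₁ _ _ _ _ hDγ hν) x
  have hLι := LinearMap.congr_fun (hcartan₂ _ _ _ _ hγ hDν) x
  have hsq : (-1 : ℂ) ^ (k - 1) * (-1 : ℂ) ^ (k - 1) = 1 := by
    rw [← mul_zpow]; simp
  simp only [LinearMap.sub_apply, LinearMap.smul_apply, LinearMap.comp_apply] at hιι hιL hLι
  simp only [LtCoeff_apply, hD_der k l γ ν hγ hν, ← hLL, map_add, map_smul, LinearMap.add_apply,
    LinearMap.smul_apply, hιι, hιL, hLι, smul_smul, hsq]
  module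

/-!
STATEMENT 5: for every `t ∈ ℂ` the operators `L^{(t)}` are compatible with the brackets:
for homogeneous `γ, ν ∈ T[[u]]` of total degrees `k, l` (so `|γ| = k − 1`, `|ν| = l − 1`),
`[L^{(t)}_γ, L^{(t)}_ν] = L^{(t)}_γ L^{(t)}_ν − (−1)^{|γ||ν|} L^{(t)}_ν L^{(t)}_γ
  = L^{(t)}_{[γ,ν]}`
as operators on `V[[u]]`, where `[γ,ν]` is the `u`-bilinear extension of the bracket of `T`
(homogeneous of total degree `k + l − 1`).  Together with the compatibility with the
differentials this says that `L^{(t)}` is a dgla module structure on `(V[[u]], u d)` over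
`(T[[u]], u D, [·,·])`.
-/
theorem Lt_compatible_with_brackets
    {T V : Type} [AddCommGroup T] [Module ℂ T] [AddCommGroup V] [Module ℂ V]
    -- the grading of `T` (with `T^{•+1}` a graded Lie algebra; `|γ| = k − 1` for `γ ∈ T^k`)
    (Tk : ℤ → Submodule ℂ T) (hT : DirectSum.IsInternal Tk)
    (bracket : T →ₗ[ℂ] T →ₗ[ℂ] T)
    (hbr_mem : ∀ (k l : ℤ) (γ ν : T), γ ∈ Tk k → ν ∈ Tk l → bracket γ ν ∈ Tk (k + l - 1))
    (hbr_skew : ∀ (k l : ℤ) (γ ν : T), γ ∈ Tk k → ν ∈ Tk l →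
      bracket γ ν = -(((-1 : ℂ) ^ ((k - 1) * (l - 1))) • bracket ν γ))
    (hbr_jacobi : ∀ (k l m : ℤ) (γ ν η : T), γ ∈ Tk k → ν ∈ Tk l → η ∈ Tk m →
      bracket γ (bracket ν η)
        = bracket (bracket γ ν) η + ((-1 : ℂ) ^ ((k - 1) * (l - 1))) • bracket ν (bracket γ η))
    -- the grading of `V` and the differential `d` of degree `−1`
    (Vk : ℤ → Submodule ℂ V) (hV : DirectSum.IsInternal Vk)
    (d : V →ₗ[ℂ] V) (hd_mem : ∀ (m : ℤ) (x : V), x ∈ Vk m → d x ∈ Vk (m - 1))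
    (hd2 : d ∘ₗ d = 0)
    -- the insertion operators `ι_γ : V^m → V^{m+k}` for `γ ∈ T^k`, linear in `γ`
    (iota : T →ₗ[ℂ] V →ₗ[ℂ] V)
    (hiota_mem : ∀ (k m : ℤ) (γ : T) (x : V), γ ∈ Tk k → x ∈ Vk m → iota γ x ∈ Vk (m + k))
    (hiota_comm : ∀ (k l : ℤ) (γ ν : T), γ ∈ Tk k → ν ∈ Tk l →
      iota γ ∘ₗ iota ν = ((-1 : ℂ) ^ (k * l)) • (iota ν ∘ₗ iota γ))
    -- the Cartan relations `ι_{[γ,ν]} = [ι_γ, L_ν] = (−1)^{|γ|} [L_γ, ι_ν]`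
    (hcartan₁ : ∀ (k l : ℤ) (γ ν : T), γ ∈ Tk k → ν ∈ Tk l →
      iota (bracket γ ν)
        = iota γ ∘ₗ Lder d iota l ν
          - ((-1 : ℂ) ^ (k * (l - 1))) • (Lder d iota l ν ∘ₗ iota γ))
    (hcartan₂ : ∀ (k l : ℤ) (γ ν : T), γ ∈ Tk k → ν ∈ Tk l →
      iota (bracket γ ν)
        = ((-1 : ℂ) ^ (k - 1)) •
            (Lder d iota k γ ∘ₗ iota ν
              - ((-1 : ℂ) ^ ((k - 1) * l)) • (iota ν ∘ₗ Lder d iota k γ)))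
    -- the divergence operator `D` of degree `−1`, a derivation of the bracket with `D² = 0`
    (D : T →ₗ[ℂ] T) (hD_mem : ∀ (k : ℤ) (γ : T), γ ∈ Tk k → D γ ∈ Tk (k - 1))
    (hD2 : D ∘ₗ D = 0)
    (hD_der : ∀ (k l : ℤ) (γ ν : T), γ ∈ Tk k → ν ∈ Tk l →
      D (bracket γ ν) = bracket (D γ) ν + ((-1 : ℂ) ^ (k - 1)) • bracket γ (D ν))
    :
    ∀ (t : ℂ) (k l : ℤ) (γ ν : ℕ → T),
      (∀ j : ℕ, γ j ∈ Tk (k - 2 * (j : ℤ))) → (∀ j : ℕ, ν j ∈ Tk (l - 2 * (j : ℤ))) →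
      ∀ (x : ℕ → V) (n : ℕ),
        Lt d iota D k γ t (Lt d iota D l ν t x) n
            - ((-1 : ℂ) ^ ((k - 1) * (l - 1))) • Lt d iota D l ν t (Lt d iota D k γ t x) n
          = Lt d iota D (k + l - 1) (ubr bracket γ ν) t x n := by
  intro t k l γ ν hγ hν x n
  have hsign (i j : ℕ) : (-1 : ℂ) ^ ((k - 1) * (l - 1))
      = (-1 : ℂ) ^ ((k - 2 * (i : ℤ) - 1) * (l - 2 * (j : ℤ) - 1)) := by
    simp only [neg_one_zpow_eq_ite_even, Int.even_mul, Int.even_sub, even_two, true_or, iff_true]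
  rw [Lt_Lt_eq_sum_antidiagonal, Lt_Lt_eq_sum_antidiagonal, Lt_eq_sum_antidiagonal,
    Finset.smul_sum, ← Finset.sum_sub_distrib]
  refine Finset.sum_congr rfl fun p _ => ?_
  rw [Finset.smul_sum, ubr,
    ← Finset.Nat.sum_antidiagonal_eq_sum_range_succ (fun i j => bracket (γ i) (ν j)),
    map_sum, LinearMap.sum_apply, Finset.smul_sum]
  conv_lhs => arg 2; rw [← Finset.Nat.sum_antidiagonal_swap]
  rw [← Finset.sum_sub_distrib]
  refine Finset.sum_congr rfl fun q hq => ?_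
  have hdeg : k + l - 1 - 2 * (p.1 : ℤ) = k - 2 * (q.1 : ℤ) + (l - 2 * (q.2 : ℤ)) - 1 := by
    rw [← Finset.HasAntidiagonal.mem_antidiagonal.mp hq]
    push_cast
    ring
  rw [hdeg, ← LtCoeff_commutator Tk bracket d hd2 iota hiota_comm hcartan₁ hcartan₂ D hD_mem
    hD_der t (hγ q.1) (hν q.2), hsign q.1 q.2, smul_sub, smul_comm]
  simp only [Prod.fst_swap, Prod.snd_swap]
end

section
/- In the setting of the Cartan calculus package with divergence operator D, the homotopy operators h^{(t)} satisfy the first infinitesimal L∞-morphism equation: for every t ∈ ℂ and every homogeneous γ ∈ T[[u]], −(d/dt) L^{(t)}_γ = [u d, h^{(t)}_γ] + h^{(t)}_{u D γ} as operators on V[[u]], where the t-derivative is taken coefficientwise (each coefficient of a fixed power of u is polynomial in t) and [·,·] is the graded commutator of operators. -/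
/-- Formal derivatives of vector-valued polynomial expressions in `s` that agree for all `s`
agree: the coefficients of such an expression are unique. -/
theorem sum_deriv_eq_of_forall_sum_eq {V : Type} [AddCommGroup V] [Module ℂ V]
    {N M : ℕ} {c a b : ℕ → V}
    (h : ∀ s : ℂ, ∑ m ∈ Finset.range N, s ^ m • c m
      = ∑ j ∈ Finset.range M, s ^ j • (a j + s • b j)) (t : ℂ) :
    ∑ m ∈ Finset.range N, ((m : ℂ) * t ^ (m - 1)) • c m
      = ∑ j ∈ Finset.range M,
          (((j : ℂ) * t ^ (j - 1)) • a j + (((j + 1 : ℕ) : ℂ) * t ^ j) • b j) := by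
  refine sub_eq_zero.1 ((Module.forall_dual_apply_eq_zero_iff ℂ _).1 fun f => ?_)
  rw [map_sub, sub_eq_zero]
  have hc : HasDerivAt (fun s : ℂ => ∑ m ∈ Finset.range N, s ^ m * f (c m))
      (∑ m ∈ Finset.range N, (m : ℂ) * t ^ (m - 1) * f (c m)) t :=
    HasDerivAt.fun_sum fun m _ => (hasDerivAt_pow m t).mul_const _
  have hab : HasDerivAt
      (fun s : ℂ => ∑ j ∈ Finset.range M, (s ^ j * f (a j) + s ^ (j + 1) * f (b j)))
      (∑ j ∈ Finset.range M,
        ((j : ℂ) * t ^ (j - 1) * f (a j) + ((j + 1 : ℕ) : ℂ) * t ^ j * f (b j))) t :=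
    HasDerivAt.fun_sum fun j _ =>
      ((hasDerivAt_pow j t).mul_const _).add ((hasDerivAt_pow (j + 1) t).mul_const _)
  have hfun : (fun s : ℂ => ∑ m ∈ Finset.range N, s ^ m * f (c m))
      = fun s : ℂ => ∑ j ∈ Finset.range M, (s ^ j * f (a j) + s ^ (j + 1) * f (b j)) := by
    funext s
    simpa [pow_succ, mul_add, mul_assoc] using congrArg f (h s)
  rw [hfun] at hc
  simpa using hc.unique hab

/-- The commutator of `u d` with `h^{(t)}_γ` is `−Σ_{j≥1} j t^{j−1} u^j L_{γ_j}`. -/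
theorem uDiff_ht_commutator {T V : Type} [AddCommGroup T] [Module ℂ T]
    [AddCommGroup V] [Module ℂ V]
    (d : V →ₗ[ℂ] V) (iota : T →ₗ[ℂ] V →ₗ[ℂ] V) (k : ℤ) (γ : ℕ → T) (t : ℂ)
    (x : ℕ → V) (n : ℕ) :
    uDiff d (ht iota γ t x) n - ((-1 : ℂ) ^ (1 * (k - 2))) • ht iota γ t (uDiff d x) n
      = -∑ j ∈ Finset.range (n + 1),
          ((j : ℂ) * t ^ (j - 1)) • Lder d iota (k - 2 * (j : ℤ)) (γ j) (x (n - j)) := by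
  have hsign (j : ℤ) : (-1 : ℂ) ^ (k - 2 * j) = (-1 : ℂ) ^ k := by
    rw [zpow_sub₀ (by norm_num), (even_two_mul j).neg_one_zpow, div_one]
  have hsign' : (-1 : ℂ) ^ (1 * (k - 2)) = (-1 : ℂ) ^ k := by
    simpa using hsign 1
  simp only [hsign', hsign, Lder]
  cases n with
  | zero => simp [uDiff, ht]
  | succ n =>
    have hr : ht iota γ t (uDiff d x) (n + 1) = -∑ j ∈ Finset.range (n + 1),
        (((j + 1 : ℕ) : ℂ) * t ^ j) • iota (γ (j + 1)) (d (x (n - j))) := by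
      rw [ht, Finset.sum_range_succ]
      simp only [Nat.sub_self, uDiff, map_zero, smul_zero, add_zero, neg_inj]
      refine Finset.sum_congr rfl fun j hj => ?_
      rw [Nat.succ_sub (Finset.mem_range_succ_iff.1 hj)]
    rw [hr, Finset.sum_range_succ' _ (n + 1)]
    simp only [uDiff, ht, map_neg, map_sum, map_smul, LinearMap.sub_apply, LinearMap.smul_apply,
      LinearMap.comp_apply, Nat.cast_zero, zero_mul, zero_smul, smul_sub,
      Finset.sum_sub_distrib, Nat.add_sub_cancel, Nat.add_sub_add_right, smul_neg,
      Finset.smul_sum, smul_comm ((-1 : ℂ) ^ k)]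
    abel

/-!
STATEMENT 6: the homotopy operators `h^{(t)}` satisfy the first infinitesimal
`L∞`-morphism equation: for every `t ∈ ℂ` and every homogeneous `γ ∈ T[[u]]` of total
degree `k`,
`−(d/dt) L^{(t)}_γ = [u d, h^{(t)}_γ] + h^{(t)}_{u D γ}`
as operators on `V[[u]]`.  The `t`-derivative is taken coefficientwise: each coefficient
of a fixed power of `u`, applied to a fixed `x ∈ V[[u]]`, is polynomial in `t`, i.e. of
the form `Σ_m t^m • c m` for a (unique) finitely supported family `c` of vectors, and its
derivative at `t` is `Σ_m m t^{m−1} • c m`.  The graded commutator `[u d, h^{(t)}_γ]`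
carries the sign `(−1)^{deg(ud)·deg(h^{(t)}_γ)} = (−1)^{1·(k−2)}`.
-/
theorem ht_first_Linfty_equation
    {T V : Type} [AddCommGroup T] [Module ℂ T] [AddCommGroup V] [Module ℂ V]
    -- the grading of `T` (with `T^{•+1}` a graded Lie algebra; `|γ| = k − 1` for `γ ∈ T^k`)
    (Tk : ℤ → Submodule ℂ T) (hT : DirectSum.IsInternal Tk)
    (bracket : T →ₗ[ℂ] T →ₗ[ℂ] T)
    (hbr_mem : ∀ (k l : ℤ) (γ ν : T), γ ∈ Tk k → ν ∈ Tk l → bracket γ ν ∈ Tk (k + l - 1))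
    (hbr_skew : ∀ (k l : ℤ) (γ ν : T), γ ∈ Tk k → ν ∈ Tk l →
      bracket γ ν = -(((-1 : ℂ) ^ ((k - 1) * (l - 1))) • bracket ν γ))
    (hbr_jacobi : ∀ (k l m : ℤ) (γ ν η : T), γ ∈ Tk k → ν ∈ Tk l → η ∈ Tk m →
      bracket γ (bracket ν η)
        = bracket (bracket γ ν) η + ((-1 : ℂ) ^ ((k - 1) * (l - 1))) • bracket ν (bracket γ η))
    -- the grading of `V` and the differential `d` of degree `−1`
    (Vk : ℤ → Submodule ℂ V) (hV : DirectSum.IsInternal Vk)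
    (d : V →ₗ[ℂ] V) (hd_mem : ∀ (m : ℤ) (x : V), x ∈ Vk m → d x ∈ Vk (m - 1))
    (hd2 : d ∘ₗ d = 0)
    -- the insertion operators `ι_γ : V^m → V^{m+k}` for `γ ∈ T^k`, linear in `γ`
    (iota : T →ₗ[ℂ] V →ₗ[ℂ] V)
    (hiota_mem : ∀ (k m : ℤ) (γ : T) (x : V), γ ∈ Tk k → x ∈ Vk m → iota γ x ∈ Vk (m + k))
    (hiota_comm : ∀ (k l : ℤ) (γ ν : T), γ ∈ Tk k → ν ∈ Tk l →
      iota γ ∘ₗ iota ν = ((-1 : ℂ) ^ (k * l)) • (iota ν ∘ₗ iota γ))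
    -- the Cartan relations `ι_{[γ,ν]} = [ι_γ, L_ν] = (−1)^{|γ|} [L_γ, ι_ν]`
    (hcartan₁ : ∀ (k l : ℤ) (γ ν : T), γ ∈ Tk k → ν ∈ Tk l →
      iota (bracket γ ν)
        = iota γ ∘ₗ Lder d iota l ν
          - ((-1 : ℂ) ^ (k * (l - 1))) • (Lder d iota l ν ∘ₗ iota γ))
    (hcartan₂ : ∀ (k l : ℤ) (γ ν : T), γ ∈ Tk k → ν ∈ Tk l →
      iota (bracket γ ν)
        = ((-1 : ℂ) ^ (k - 1)) •
            (Lder d iota k γ ∘ₗ iota ν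
              - ((-1 : ℂ) ^ ((k - 1) * l)) • (iota ν ∘ₗ Lder d iota k γ)))
    -- the divergence operator `D` of degree `−1`, a derivation of the bracket with `D² = 0`
    (D : T →ₗ[ℂ] T) (hD_mem : ∀ (k : ℤ) (γ : T), γ ∈ Tk k → D γ ∈ Tk (k - 1))
    (hD2 : D ∘ₗ D = 0)
    (hD_der : ∀ (k l : ℤ) (γ ν : T), γ ∈ Tk k → ν ∈ Tk l →
      D (bracket γ ν) = bracket (D γ) ν + ((-1 : ℂ) ^ (k - 1)) • bracket γ (D ν))
    :
    ∀ (t : ℂ) (k : ℤ) (γ : ℕ → T), (∀ j : ℕ, γ j ∈ Tk (k - 2 * (j : ℤ))) →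
      ∀ (x : ℕ → V) (n : ℕ) (N : ℕ) (c : ℕ → V),
        -- `c` is the coefficient family of the polynomial function `s ↦ L^{(s)}_γ x` (in
        -- `u`-degree `n`); its formal derivative computes `(d/dt) L^{(t)}_γ`.
        (∀ s : ℂ, Lt d iota D k γ s x n = ∑ m ∈ Finset.range N, s ^ m • c m) →
        -(∑ m ∈ Finset.range N, ((m : ℂ) * t ^ (m - 1)) • c m)
          = (uDiff d (ht iota γ t x) n
              - ((-1 : ℂ) ^ (1 * (k - 2))) • ht iota γ t (uDiff d x) n)
            + ht iota (uMapT D γ) t x n := by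
  intro t k γ _ x n N c hc
  have hab := sum_deriv_eq_of_forall_sum_eq (M := n + 1)
    (a := fun j => Lder d iota (k - 2 * (j : ℤ)) (γ j) (x (n - j)))
    (b := fun j => iota (D (γ j)) (x (n - j))) (fun s => (hc s).symm) t
  rw [hab, uDiff_ht_commutator, Finset.sum_add_distrib, neg_add]
  rfl
end

section
/- In the setting of the Cartan calculus package with divergence operator D, the homotopy operators h^{(t)} satisfy the second infinitesimal L∞-morphism equation: for every t ∈ ℂ and all homogeneous γ, ν ∈ T[[u]], h^{(t)}_{[γ,ν]} = [h^{(t)}_γ, L^{(t)}_ν] + (−1)^{|γ|} [L^{(t)}_γ, h^{(t)}_ν] as operators on V[[u]], where [γ,ν] is the u-bilinear extension of the bracket of T and [·,·] on the right-hand side denotes graded commutators of operators. -/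
/-- The operator `Σ_{j≥0} u^j A_j` on `V[[u]]`. -/
def uOp {V : Type} [AddCommGroup V] [Module ℂ V] (A : ℕ → Module.End ℂ V) (x : ℕ → V) (n : ℕ) : V :=
  ∑ p ∈ Finset.HasAntidiagonal.antidiagonal n, A p.1 (x p.2)

theorem uOp_eq_sum_range {V : Type} [AddCommGroup V] [Module ℂ V] (A : ℕ → Module.End ℂ V)
    (x : ℕ → V) (n : ℕ) : uOp A x n = ∑ j ∈ Finset.range (n + 1), A j (x (n - j)) :=
  Finset.Nat.sum_antidiagonal_eq_sum_range_succ (fun i j => A i (x j)) n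

/-- Composition of operators on `V[[u]]` is given by the Cauchy product of the coefficients. -/
theorem uOp_uOp {V : Type} [AddCommGroup V] [Module ℂ V] (A B : ℕ → Module.End ℂ V)
    (x : ℕ → V) (n : ℕ) :
    uOp A (uOp B x) n = uOp (fun m => ∑ p ∈ Finset.HasAntidiagonal.antidiagonal m, A p.1 * B p.2) x n := by
  simp only [uOp, map_sum, LinearMap.sum_apply, Module.End.mul_apply, Finset.sum_sigma']
  refine Finset.sum_nbij' (fun q => ⟨(q.1.1 + q.2.1, q.2.2), (q.1.1, q.2.1)⟩)
    (fun q => ⟨(q.2.1, q.2.2 + q.1.2), (q.2.2, q.1.2)⟩) ?_ ?_ ?_ ?_ ?_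
  · rintro ⟨⟨i, r⟩, j, s⟩ h
    simp only [Finset.mem_sigma, Finset.HasAntidiagonal.mem_antidiagonal] at h ⊢
    constructor <;> grind
  · rintro ⟨⟨m, s⟩, i, j⟩ h
    simp only [Finset.mem_sigma, Finset.HasAntidiagonal.mem_antidiagonal] at h ⊢
    constructor <;> grind
  · rintro ⟨⟨i, r⟩, j, s⟩ h
    obtain ⟨-, rfl⟩ := by simpa only [Finset.mem_sigma, Finset.HasAntidiagonal.mem_antidiagonal] using h
    rfl
  · rintro ⟨⟨m, s⟩, i, j⟩ h
    obtain ⟨-, rfl⟩ := by simpa only [Finset.mem_sigma, Finset.HasAntidiagonal.mem_antidiagonal] using h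
    rfl
  · rintro ⟨⟨i, r⟩, j, s⟩ -
    rfl

theorem uOp_add {V : Type} [AddCommGroup V] [Module ℂ V] (A B : ℕ → Module.End ℂ V)
    (x : ℕ → V) (n : ℕ) : uOp (fun m => A m + B m) x n = uOp A x n + uOp B x n := by
  simp [uOp, Finset.sum_add_distrib]

theorem uOp_smul {V : Type} [AddCommGroup V] [Module ℂ V] (c : ℂ) (A : ℕ → Module.End ℂ V)
    (x : ℕ → V) (n : ℕ) : uOp (fun m => c • A m) x n = c • uOp A x n := by
  simp [uOp, Finset.smul_sum]

/-- Graded commutators (with sign `c`) of operators on `V[[u]]` are computed coefficientwise. -/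
theorem uOp_commutator {V : Type} [AddCommGroup V] [Module ℂ V] (c : ℂ)
    (A B : ℕ → Module.End ℂ V) (x : ℕ → V) (n : ℕ) :
    uOp A (uOp B x) n - c • uOp B (uOp A x) n
      = uOp (fun m => ∑ p ∈ Finset.HasAntidiagonal.antidiagonal m,
          (A p.1 * B p.2 - c • (B p.2 * A p.1))) x n := by
  have hswap : ∀ m, ∑ p ∈ Finset.HasAntidiagonal.antidiagonal m, B p.1 * A p.2
      = ∑ p ∈ Finset.HasAntidiagonal.antidiagonal m, B p.2 * A p.1 := fun m =>
    (Finset.Nat.sum_antidiagonal_swap (f := fun p : ℕ × ℕ => B p.1 * A p.2)).symm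
  simp only [uOp_uOp, hswap]
  rw [sub_eq_add_neg, ← neg_smul, ← uOp_smul, ← uOp_add]
  simp only [Finset.smul_sum, ← Finset.sum_add_distrib, neg_smul, ← sub_eq_add_neg]

theorem ht_eq_uOp {T V : Type} [AddCommGroup T] [Module ℂ T] [AddCommGroup V] [Module ℂ V]
    (iota : T →ₗ[ℂ] V →ₗ[ℂ] V) (γ : ℕ → T) (t : ℂ) (x : ℕ → V) :
    ht iota γ t x = uOp (fun j => -(((j + 1 : ℕ) : ℂ) * t ^ j) • iota (γ (j + 1))) x := by
  funext n
  rw [uOp_eq_sum_range]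
  simp only [ht, LinearMap.smul_apply, neg_smul, LinearMap.neg_apply, Finset.sum_neg_distrib]

theorem Lt_eq_uOp {T V : Type} [AddCommGroup T] [Module ℂ T] [AddCommGroup V] [Module ℂ V]
    (d : V →ₗ[ℂ] V) (iota : T →ₗ[ℂ] V →ₗ[ℂ] V) (D : T →ₗ[ℂ] T)
    (k : ℤ) (γ : ℕ → T) (t : ℂ) (x : ℕ → V) :
    Lt d iota D k γ t x
      = uOp (fun j => t ^ j • (Lder d iota (k - 2 * (j : ℤ)) (γ j) + t • iota (D (γ j)))) x := by
  funext n
  rw [uOp_eq_sum_range]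
  rfl

theorem neg_one_zpow_eq_of_even_sub {a b : ℤ} (h : Even (a - b)) : (-1 : ℂ) ^ a = (-1) ^ b := by
  rw [← sub_add_cancel a b, zpow_add₀ (by norm_num), h.neg_one_zpow, one_mul]

/-- The index-weighted Cauchy sum of `f` splits by the Leibniz rule. -/
theorem sum_antidiagonal_leibniz {M : Type} [AddCommGroup M] [Module ℂ M] (f : ℕ → ℕ → M) (m : ℕ) :
    ((m + 1 : ℕ) : ℂ) • ∑ p ∈ Finset.HasAntidiagonal.antidiagonal (m + 1), f p.1 p.2
      = ∑ p ∈ Finset.HasAntidiagonal.antidiagonal m, (((p.1 + 1 : ℕ) : ℂ) • f (p.1 + 1) p.2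
          + ((p.2 + 1 : ℕ) : ℂ) • f p.1 (p.2 + 1)) := by
  have h₁ := Finset.Nat.sum_antidiagonal_succ (n := m)
    (f := fun p : ℕ × ℕ => (p.1 : ℂ) • f p.1 p.2)
  have h₂ := Finset.Nat.sum_antidiagonal_succ' (n := m)
    (f := fun p : ℕ × ℕ => (p.2 : ℂ) • f p.1 p.2)
  simp only [Nat.cast_zero, zero_smul, zero_add] at h₁ h₂
  rw [Finset.sum_add_distrib, ← h₁, ← h₂, ← Finset.sum_add_distrib, Finset.smul_sum]
  refine Finset.sum_congr rfl fun p hp => ?_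
  rw [← Finset.HasAntidiagonal.mem_antidiagonal.mp hp, Nat.cast_add, add_smul]

/-!
STATEMENT 7: the homotopy operators `h^{(t)}` satisfy the second infinitesimal
`L∞`-morphism equation: for every `t ∈ ℂ` and all homogeneous `γ, ν ∈ T[[u]]` of total
degrees `k, l`,
`h^{(t)}_{[γ,ν]} = [h^{(t)}_γ, L^{(t)}_ν] + (−1)^{|γ|} [L^{(t)}_γ, h^{(t)}_ν]`
as operators on `V[[u]]`, where `[γ,ν]` is the `u`-bilinear extension of the bracket of `T`
and the right-hand side brackets are graded commutators of operators
(`h^{(t)}_γ` has degree `k − 2`, `L^{(t)}_ν` has degree `l − 1`, etc., and `|γ| = k − 1`).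
-/
theorem ht_second_Linfty_equation
    {T V : Type} [AddCommGroup T] [Module ℂ T] [AddCommGroup V] [Module ℂ V]
    -- the grading of `T` (with `T^{•+1}` a graded Lie algebra; `|γ| = k − 1` for `γ ∈ T^k`)
    (Tk : ℤ → Submodule ℂ T) (hT : DirectSum.IsInternal Tk)
    (bracket : T →ₗ[ℂ] T →ₗ[ℂ] T)
    (hbr_mem : ∀ (k l : ℤ) (γ ν : T), γ ∈ Tk k → ν ∈ Tk l → bracket γ ν ∈ Tk (k + l - 1))
    (hbr_skew : ∀ (k l : ℤ) (γ ν : T), γ ∈ Tk k → ν ∈ Tk l →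
      bracket γ ν = -(((-1 : ℂ) ^ ((k - 1) * (l - 1))) • bracket ν γ))
    (hbr_jacobi : ∀ (k l m : ℤ) (γ ν η : T), γ ∈ Tk k → ν ∈ Tk l → η ∈ Tk m →
      bracket γ (bracket ν η)
        = bracket (bracket γ ν) η + ((-1 : ℂ) ^ ((k - 1) * (l - 1))) • bracket ν (bracket γ η))
    -- the grading of `V` and the differential `d` of degree `−1`
    (Vk : ℤ → Submodule ℂ V) (hV : DirectSum.IsInternal Vk)
    (d : V →ₗ[ℂ] V) (hd_mem : ∀ (m : ℤ) (x : V), x ∈ Vk m → d x ∈ Vk (m - 1))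
    (hd2 : d ∘ₗ d = 0)
    -- the insertion operators `ι_γ : V^m → V^{m+k}` for `γ ∈ T^k`, linear in `γ`
    (iota : T →ₗ[ℂ] V →ₗ[ℂ] V)
    (hiota_mem : ∀ (k m : ℤ) (γ : T) (x : V), γ ∈ Tk k → x ∈ Vk m → iota γ x ∈ Vk (m + k))
    (hiota_comm : ∀ (k l : ℤ) (γ ν : T), γ ∈ Tk k → ν ∈ Tk l →
      iota γ ∘ₗ iota ν = ((-1 : ℂ) ^ (k * l)) • (iota ν ∘ₗ iota γ))
    -- the Cartan relations `ι_{[γ,ν]} = [ι_γ, L_ν] = (−1)^{|γ|} [L_γ, ι_ν]`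
    (hcartan₁ : ∀ (k l : ℤ) (γ ν : T), γ ∈ Tk k → ν ∈ Tk l →
      iota (bracket γ ν)
        = iota γ ∘ₗ Lder d iota l ν
          - ((-1 : ℂ) ^ (k * (l - 1))) • (Lder d iota l ν ∘ₗ iota γ))
    (hcartan₂ : ∀ (k l : ℤ) (γ ν : T), γ ∈ Tk k → ν ∈ Tk l →
      iota (bracket γ ν)
        = ((-1 : ℂ) ^ (k - 1)) •
            (Lder d iota k γ ∘ₗ iota ν
              - ((-1 : ℂ) ^ ((k - 1) * l)) • (iota ν ∘ₗ Lder d iota k γ)))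
    -- the divergence operator `D` of degree `−1`, a derivation of the bracket with `D² = 0`
    (D : T →ₗ[ℂ] T) (hD_mem : ∀ (k : ℤ) (γ : T), γ ∈ Tk k → D γ ∈ Tk (k - 1))
    (hD2 : D ∘ₗ D = 0)
    (hD_der : ∀ (k l : ℤ) (γ ν : T), γ ∈ Tk k → ν ∈ Tk l →
      D (bracket γ ν) = bracket (D γ) ν + ((-1 : ℂ) ^ (k - 1)) • bracket γ (D ν))
    :
    ∀ (t : ℂ) (k l : ℤ) (γ ν : ℕ → T),
      (∀ j : ℕ, γ j ∈ Tk (k - 2 * (j : ℤ))) → (∀ j : ℕ, ν j ∈ Tk (l - 2 * (j : ℤ))) →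
      ∀ (x : ℕ → V) (n : ℕ),
        ht iota (ubr bracket γ ν) t x n
          = (ht iota γ t (Lt d iota D l ν t x) n
              - ((-1 : ℂ) ^ ((k - 2) * (l - 1))) • Lt d iota D l ν t (ht iota γ t x) n)
            + ((-1 : ℂ) ^ (k - 1)) •
              (Lt d iota D k γ t (ht iota ν t x) n
                - ((-1 : ℂ) ^ ((k - 1) * (l - 2))) • ht iota ν t (Lt d iota D k γ t x) n) := by
  intro t k l γ ν hγ hν x n
  have hcomm₁ : ∀ i j : ℕ,
      (-(((i + 1 : ℕ) : ℂ) * t ^ i) • iota (γ (i + 1)) : Module.End ℂ V)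
          * (t ^ j • (Lder d iota (l - 2 * (j : ℤ)) (ν j) + t • iota (D (ν j))))
        - ((-1 : ℂ) ^ ((k - 2) * (l - 1))) •
          ((t ^ j • (Lder d iota (l - 2 * (j : ℤ)) (ν j) + t • iota (D (ν j))))
            * (-(((i + 1 : ℕ) : ℂ) * t ^ i) • iota (γ (i + 1)) : Module.End ℂ V))
        = -(t ^ (i + j)) • ((i + 1 : ℕ) : ℂ) • iota (bracket (γ (i + 1)) (ν j)) := by
    intro i j
    have hc := hcartan₁ _ _ _ _ (hγ (i + 1)) (hν j)
    have hi := hiota_comm _ _ _ _ (hγ (i + 1)) (hD_mem _ _ (hν j))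
    rw [neg_one_zpow_eq_of_even_sub (b := (k - 2) * (l - 1))] at hc hi
    · rw [← Module.End.mul_eq_comp, ← Module.End.mul_eq_comp] at hc hi
      rw [hc]
      simp only [smul_mul_assoc, mul_smul_comm, mul_add, add_mul, hi]
      module
    all_goals push_cast; simp [parity_simps]
  have hcomm₂ : ∀ i j : ℕ,
      ((-1 : ℂ) ^ (k - 1)) •
        ((t ^ i • (Lder d iota (k - 2 * (i : ℤ)) (γ i) + t • iota (D (γ i))))
            * (-(((j + 1 : ℕ) : ℂ) * t ^ j) • iota (ν (j + 1)) : Module.End ℂ V)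
          - ((-1 : ℂ) ^ ((k - 1) * (l - 2))) •
            ((-(((j + 1 : ℕ) : ℂ) * t ^ j) • iota (ν (j + 1)) : Module.End ℂ V)
              * (t ^ i • (Lder d iota (k - 2 * (i : ℤ)) (γ i) + t • iota (D (γ i))))))
        = -(t ^ (i + j)) • ((j + 1 : ℕ) : ℂ) • iota (bracket (γ i) (ν (j + 1))) := by
    intro i j
    have hc := hcartan₂ _ _ _ _ (hγ i) (hν (j + 1))
    have hi := hiota_comm _ _ _ _ (hD_mem _ _ (hγ i)) (hν (j + 1))
    rw [neg_one_zpow_eq_of_even_sub (a := k - 2 * (i : ℤ) - 1) (b := k - 1),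
      neg_one_zpow_eq_of_even_sub (a := (k - 2 * (i : ℤ) - 1) * (l - 2 * ((j + 1 : ℕ) : ℤ)))
        (b := (k - 1) * (l - 2))] at hc
    rw [neg_one_zpow_eq_of_even_sub (b := (k - 1) * (l - 2))] at hi
    · rw [← Module.End.mul_eq_comp, ← Module.End.mul_eq_comp] at hc hi
      rw [hc]
      simp only [smul_mul_assoc, mul_smul_comm, mul_add, add_mul, hi]
      module
    all_goals push_cast; simp [parity_simps]
  simp only [ht_eq_uOp, Lt_eq_uOp, uOp_commutator]
  rw [← uOp_smul, ← uOp_add]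
  congr 1
  funext m
  rw [Finset.smul_sum, ← Finset.sum_add_distrib]
  simp only [hcomm₁, hcomm₂]
  have hbr : iota (ubr bracket γ ν (m + 1))
      = ∑ p ∈ Finset.HasAntidiagonal.antidiagonal (m + 1), iota (bracket (γ p.1) (ν p.2)) := by
    rw [← map_sum, ubr, Finset.Nat.sum_antidiagonal_eq_sum_range_succ
      (fun i j => bracket (γ i) (ν j))]
  rw [hbr, mul_comm, ← neg_mul, mul_smul,
    sum_antidiagonal_leibniz (fun i j => iota (bracket (γ i) (ν j))), Finset.smul_sum]
  refine Finset.sum_congr rfl fun p hp => ?_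
  rw [smul_add, Finset.HasAntidiagonal.mem_antidiagonal.mp hp]
end
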